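/- Trichotomy for realizable apple tasting: for any hypothesis class H, the minimax expected number of mistakes over T rounds under apple tasting feedback in the realizable setting is Θ(1) if W(H) = 1, Θ(√T) if 2 ≤ W(H) < ∞, and Θ(T) if W(H) = ∞. -/

import Mathlib

open scoped ENNReal NNReal


/-- `ALShatter H w d` : the hypothesis class `H` shatters some Apple Littlestone tree of
width `w` and depth `d`. Width `0` means the path has already ended (took the maximal
number of right/1 edges), in which case shattering only requires a consistent hypothesis. -/
def ALShatter {X : Type*} : Set (X → Bool) → ℕ → ℕ → Prop
  | H, _, 0 => H.Nonempty
  | H, 0, _ + 1 => H.Nonempty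
  | H, w + 1, d + 1 =>
      ∃ x : X, ALShatter {h | h ∈ H ∧ h x = false} (w + 1) d ∧
               ALShatter {h | h ∈ H ∧ h x = true} w d

/-- The Apple Littlestone dimension of `H` at width `w`. -/
noncomputable def ALdim {X : Type*} (H : Set (X → Bool)) (w : ℕ) : ℕ∞ :=
  sSup {d : ℕ∞ | ∃ n : ℕ, ALShatter H w n ∧ d = (n : ℕ∞)}

/-- `LShatter H d` : `H` shatters some Littlestone tree of depth `d`. -/
def LShatter {X : Type*} : Set (X → Bool) → ℕ → Prop
  | H, 0 => H.Nonempty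
  | H, d + 1 =>
      ∃ x : X, LShatter {h | h ∈ H ∧ h x = false} d ∧
               LShatter {h | h ∈ H ∧ h x = true} d

/-- The Littlestone dimension of `H`. -/
noncomputable def Ldim {X : Type*} (H : Set (X → Bool)) : ℕ∞ :=
  sSup {d : ℕ∞ | ∃ n : ℕ, LShatter H n ∧ d = (n : ℕ∞)}

/-- The Effective width of `H`: the least width `w ≥ 1` at which the
Apple Littlestone dimension is finite. -/
noncomputable def EffW {X : Type*} (H : Set (X → Bool)) : ℕ∞ :=
  sInf {w : ℕ∞ | ∃ n : ℕ, 1 ≤ n ∧ ALdim H n ≠ ⊤ ∧ w = (n : ℕ∞)}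
/-- One run of a randomized apple-tasting learner `A` (a map from the apple-tasting
history — past instances together with the label if it was observed — and the current
instance, to a distribution over predictions) on the stream `x` with true labels `y`:
the distribution, after `t` rounds, of the pair (history, number of mistakes so far).
The label `y t` is recorded (observed) only when the prediction is 1. -/
noncomputable def runAT {X : Type*} (A : List (X × Option Bool) → X → PMF Bool)
    (x : ℕ → X) (y : ℕ → Bool) : ℕ → PMF (List (X × Option Bool) × ℕ)
  | 0 => PMF.pure ([], 0)
  | t + 1 =>
      (runAT A x y t).bind fun s =>
        (A s.1 (x t)).bind fun b =>
          PMF.pure (s.1 ++ [(x t, if b then some (y t) else none)],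
            s.2 + (if b ≠ y t then 1 else 0))

/-- Expected number of mistakes of the randomized apple-tasting learner `A` over `T`
rounds on the stream `x` with true labels `y`. -/
noncomputable def expMistakes {X : Type*} (A : List (X × Option Bool) → X → PMF Bool)
    (x : ℕ → X) (y : ℕ → Bool) (T : ℕ) : ℝ≥0∞ :=
  ∑' s : List (X × Option Bool) × ℕ, runAT A x y T s * s.2

/-- The minimax expected number of mistakes over T rounds in the realizable setting
under apple tasting feedback: infimum over randomized apple-tasting learners of the
supremum over hypotheses in H and streams of the expected number of mistakes. -/
noncomputable def minimaxMistakes {X : Type*} (H : Set (X → Bool)) (T : ℕ) : ℝ≥0∞ :=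
  ⨅ A : List (X × Option Bool) → X → PMF Bool,
    ⨆ h ∈ H, ⨆ x : ℕ → X, expMistakes A x (fun t => h (x t)) T

/-! ### Expectations along a run -/

namespace AppleTasting

variable {X : Type*}

/-- The expectation of `F` over the state of a run after `t` rounds. -/
noncomputable def runMean (A : List (X × Option Bool) → X → PMF Bool) (x : ℕ → X) (y : ℕ → Bool)
    (t : ℕ) (F : List (X × Option Bool) × ℕ → ℝ≥0∞) : ℝ≥0∞ :=
  ∑' s, runAT A x y t s * F s

/-- The expectation of `F` after one more round played from the state `s`. -/
noncomputable def stepMean (A : List (X × Option Bool) → X → PMF Bool) (x₀ : X) (b : Bool)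
    (F : List (X × Option Bool) × ℕ → ℝ≥0∞) (s : List (X × Option Bool) × ℕ) : ℝ≥0∞ :=
  A s.1 x₀ true * F (s.1 ++ [(x₀, some b)], s.2 + if true ≠ b then 1 else 0) +
    A s.1 x₀ false * F (s.1 ++ [(x₀, none)], s.2 + if false ≠ b then 1 else 0)

lemma tsum_bind_mul {α β : Type*} (p : PMF α) (f : α → PMF β) (F : β → ℝ≥0∞) :
    ∑' s, p.bind f s * F s = ∑' a, p a * ∑' s, f a s * F s := by
  simp_rw [PMF.bind_apply, ← ENNReal.tsum_mul_right, ← ENNReal.tsum_mul_left]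
  rw [ENNReal.tsum_comm]
  simp_rw [mul_assoc]

lemma tsum_pure_mul {α : Type*} (a : α) (F : α → ℝ≥0∞) : ∑' s, PMF.pure a s * F s = F a := by
  rw [tsum_eq_single a]
  · simp
  · intro b hb
    simp [PMF.pure_apply_of_ne _ _ hb]

lemma apply_true_add_apply_false (p : PMF Bool) : p true + p false = 1 := by
  rw [← p.tsum_coe, tsum_bool, add_comm]

section

variable (A : List (X × Option Bool) → X → PMF Bool) {x x' : ℕ → X} {y y' : ℕ → Bool}

lemma runMean_zero (x : ℕ → X) (y : ℕ → Bool) (F : List (X × Option Bool) × ℕ → ℝ≥0∞) :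
    runMean A x y 0 F = F ([], 0) :=
  tsum_pure_mul _ _

lemma runMean_succ (x : ℕ → X) (y : ℕ → Bool) (t : ℕ) (F : List (X × Option Bool) × ℕ → ℝ≥0∞) :
    runMean A x y (t + 1) F = runMean A x y t (stepMean A (x t) (y t) F) := by
  simp only [runMean, runAT, tsum_bind_mul, tsum_pure_mul, tsum_bool, stepMean]
  simp [add_comm]

lemma runMean_mono (t : ℕ) {F G : List (X × Option Bool) × ℕ → ℝ≥0∞} (h : ∀ s, F s ≤ G s) :
    runMean A x y t F ≤ runMean A x y t G :=
  ENNReal.tsum_le_tsum fun s => by gcongr; exact h s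

lemma runMean_add (t : ℕ) (F G : List (X × Option Bool) × ℕ → ℝ≥0∞) :
    runMean A x y t (fun s => F s + G s) = runMean A x y t F + runMean A x y t G := by
  simp only [runMean, mul_add, ENNReal.tsum_add]

lemma runMean_const (t : ℕ) (c : ℝ≥0∞) : runMean A x y t (fun _ => c) = c := by
  simp only [runMean, ENNReal.tsum_mul_right, PMF.tsum_coe, one_mul]

lemma runMean_const_mul (t : ℕ) (c : ℝ≥0∞) (F : List (X × Option Bool) × ℕ → ℝ≥0∞) :
    runMean A x y t (fun s => c * F s) = c * runMean A x y t F := by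
  simp only [runMean, ← ENNReal.tsum_mul_left]
  exact tsum_congr fun s => by ring

lemma expMistakes_eq_runMean (t : ℕ) :
    expMistakes A x y t = runMean A x y t (fun s => (s.2 : ℝ≥0∞)) := rfl

lemma runAT_congr {t : ℕ} (h : ∀ s < t, x s = x' s ∧ y s = y' s) :
    runAT A x y t = runAT A x' y' t := by
  induction t with
  | zero => rfl
  | succ t ih =>
    simp only [runAT, ih fun s hs => h s (by omega), (h t (by omega)).1, (h t (by omega)).2]

lemma expMistakes_congr {t : ℕ} (h : ∀ s < t, x s = x' s ∧ y s = y' s) :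
    expMistakes A x y t = expMistakes A x' y' t := by
  simp only [expMistakes, runAT_congr A h]

lemma stepMean_mistakes (x₀ : X) (b : Bool) (s : List (X × Option Bool) × ℕ) :
    stepMean A x₀ b (fun s => (s.2 : ℝ≥0∞)) s = s.2 + A s.1 x₀ (!b) := by
  have h := apply_true_add_apply_false (A s.1 x₀)
  have h' : (s.2 : ℝ≥0∞) = A s.1 x₀ true * s.2 + A s.1 x₀ false * s.2 := by
    rw [← add_mul, h, one_mul]
  cases b
  · simp only [stepMean]
    conv_rhs => rw [h']
    simp
    ring
  · simp only [stepMean]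
    conv_rhs => rw [h']
    simp
    ring

lemma expMistakes_succ (t : ℕ) :
    expMistakes A x y (t + 1) =
      expMistakes A x y t + runMean A x y t (fun s => A s.1 (x t) (!y t)) := by
  rw [expMistakes_eq_runMean, runMean_succ]
  rw [funext (stepMean_mistakes A (x t) (y t))]
  exact runMean_add A t _ _

lemma expMistakes_mono : Monotone (expMistakes A x y) :=
  monotone_nat_of_le_succ fun t => by rw [expMistakes_succ]; exact le_self_add

lemma runMean_le_of_stepMean_le {F : List (X × Option Bool) × ℕ → ℝ≥0∞} {c : ℝ≥0∞}
    (h : ∀ t s, stepMean A (x t) (y t) F s ≤ F s + c) (t : ℕ) :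
    runMean A x y t F ≤ F ([], 0) + t * c := by
  induction t with
  | zero => simp [runMean_zero]
  | succ t ih =>
    rw [runMean_succ]
    calc _ ≤ runMean A x y t (fun s => F s + c) := runMean_mono A t (h t)
      _ = runMean A x y t F + c := by rw [runMean_add, runMean_const]
      _ ≤ F ([], 0) + t * c + c := by gcongr
      _ = _ := by push_cast; ring

lemma runMean_le_of_le_stepMean {F : ℕ → List (X × Option Bool) × ℕ → ℝ≥0∞} {t : ℕ}
    (h : ∀ j, t ≤ j → ∀ r s, F (r + 1) s ≤ stepMean A (x j) (y j) (F r) s) (k : ℕ) :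
    runMean A x y t (F k) ≤ runMean A x y (t + k) (F 0) := by
  induction k generalizing t with
  | zero => rfl
  | succ k ih =>
    calc _ ≤ runMean A x y t (stepMean A (x t) (y t) (F k)) := runMean_mono A t (h t le_rfl k)
      _ = runMean A x y (t + 1) (F k) := (runMean_succ A x y t _).symm
      _ ≤ runMean A x y (t + 1 + k) (F 0) := ih fun j hj => h j (by omega)
      _ = _ := by rw [show t + 1 + k = t + (k + 1) by omega]

end

lemma minimaxMistakes_le_of_learner {H : Set (X → Bool)} {T : ℕ} {C : ℝ≥0∞}
    (A : List (X × Option Bool) → X → PMF Bool)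
    (h : ∀ f ∈ H, ∀ x : ℕ → X, expMistakes A x (fun t => f (x t)) T ≤ C) :
    minimaxMistakes H T ≤ C :=
  (iInf_le _ A).trans (iSup₂_le fun f hf => iSup_le fun x => h f hf x)

lemma le_minimaxMistakes {H : Set (X → Bool)} {T : ℕ} {C : ℝ≥0∞}
    (h : ∀ A : List (X × Option Bool) → X → PMF Bool,
      ∃ f ∈ H, ∃ x : ℕ → X, C ≤ expMistakes A x (fun t => f (x t)) T) :
    C ≤ minimaxMistakes H T := by
  refine le_iInf fun A => ?_
  obtain ⟨f, hf, x, hx⟩ := h A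
  exact le_iSup₂_of_le f hf (le_iSup_of_le x hx)

lemma minimaxMistakes_le_rounds (H : Set (X → Bool)) (T : ℕ) : minimaxMistakes H T ≤ T := by
  refine minimaxMistakes_le_of_learner (fun _ _ => PMF.pure true) fun f _ x => ?_
  rw [expMistakes_eq_runMean]
  refine (runMean_le_of_stepMean_le _ (c := 1) (fun t s => ?_) T).trans (by simp)
  rw [stepMean_mistakes]
  gcongr
  exact PMF.coe_le_one _ _

/-! ### Shattering and dimensions -/

lemma _root_.ALShatter.nonempty {H : Set (X → Bool)} {w d : ℕ} (h : ALShatter H w d) : H.Nonempty := by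
  induction d generalizing H with
  | zero => simpa [ALShatter] using h
  | succ d ih =>
    cases w with
    | zero => simpa [ALShatter] using h
    | succ w =>
      simp only [ALShatter] at h
      obtain ⟨_, h, _⟩ := h
      exact (ih h).mono fun f hf => hf.1

lemma ALShatter_width_zero {H : Set (X → Bool)} {d : ℕ} : ALShatter H 0 d ↔ H.Nonempty :=
  ⟨ALShatter.nonempty, fun h => by cases d <;> simpa [ALShatter] using h⟩

lemma _root_.ALShatter.of_succ {H : Set (X → Bool)} {w d : ℕ} (h : ALShatter H w (d + 1)) :
    ALShatter H w d := by
  induction d generalizing H w with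
  | zero => simpa [ALShatter] using h.nonempty
  | succ d ih =>
    cases w with
    | zero => exact ALShatter_width_zero.2 h.nonempty
    | succ w =>
      rw [ALShatter] at h ⊢
      obtain ⟨x, h₀, h₁⟩ := h
      exact ⟨x, ih h₀, ih h₁⟩

lemma _root_.ALShatter.mono {H : Set (X → Bool)} {w d e : ℕ} (hde : d ≤ e) (h : ALShatter H w e) :
    ALShatter H w d := by
  induction hde with
  | refl => exact h
  | step _ ih => exact ih h.of_succ

lemma _root_.ALShatter.toLShatter {H : Set (X → Bool)} {w d : ℕ} (hdw : d ≤ w) (h : ALShatter H w d) :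
    LShatter H d := by
  induction d generalizing H w with
  | zero => simpa [LShatter, ALShatter] using h
  | succ d ih =>
    obtain ⟨w, rfl⟩ : ∃ v, w = v + 1 := ⟨w - 1, by omega⟩
    rw [ALShatter] at h
    rw [LShatter]
    obtain ⟨x, h₀, h₁⟩ := h
    exact ⟨x, ih (by omega) h₀, ih (by omega) h₁⟩

lemma ALShatter_of_ALdim_eq_top {H : Set (X → Bool)} {w : ℕ} (h : ALdim H w = ⊤) (d : ℕ) :
    ALShatter H w d := by
  have hd : (d : ℕ∞) < ALdim H w := h ▸ ENat.natCast_lt_top d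
  obtain ⟨_, ⟨n, hn, rfl⟩, hdn⟩ := lt_sSup_iff.1 hd
  exact hn.mono (by exact_mod_cast hdn.le)

lemma exists_not_ALShatter {H : Set (X → Bool)} {w : ℕ} (h : ALdim H w ≠ ⊤) :
    ∃ n, ¬ ALShatter H w n := by
  by_contra! hs
  exact h (ENat.eq_top_iff_forall_ge.2 fun n => le_sSup ⟨n, hs n, rfl⟩)

lemma ALdim_eq_top_of_lt_EffW {H : Set (X → Bool)} {w : ℕ} (hw : 1 ≤ w) (h : w < EffW H) :
    ALdim H w = ⊤ := by
  by_contra hne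
  exact h.not_ge (sInf_le ⟨w, hw, hne, rfl⟩)

lemma exists_EffW_eq {H : Set (X → Bool)} (h : EffW H ≠ ⊤) :
    ∃ w : ℕ, 1 ≤ w ∧ ALdim H w ≠ ⊤ ∧ EffW H = w := by
  refine csInf_mem (s := {w : ℕ∞ | ∃ n : ℕ, 1 ≤ n ∧ ALdim H n ≠ ⊤ ∧ w = (n : ℕ∞)}) ?_
  by_contra hs
  rw [Set.not_nonempty_iff_eq_empty] at hs
  exact h (by rw [EffW, hs, sInf_empty])

/-! ### The learner -/

/-- What the learner tracks: the hypotheses consistent with the observed mistakes, a width, and a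
depth such that these hypotheses shatter no Apple Littlestone tree of that width and depth. -/
structure Version (X : Type*) where
  hyps : Set (X → Bool)
  width : ℕ
  depth : ℕ

namespace Version

/-- The hypotheses labelling `x` by `0` are still rich, so that a label `1` at `x` would lower
the width. -/
def Explores (V : Version X) (x : X) : Prop :=
  ALShatter {h | h ∈ V.hyps ∧ h x = false} V.width (V.depth - 1)

open Classical in
/-- The update after one round. -/
noncomputable def next (V : Version X) : X × Option Bool → Version X
  | (_, none) => V
  | (x, some true) =>
    if V.Explores x then ⟨{h | h ∈ V.hyps ∧ h x = true}, V.width - 1, V.depth - 1⟩ else V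
  | (x, some false) =>
    if V.Explores x then V else ⟨{h | h ∈ V.hyps ∧ h x = false}, V.width, V.depth - 1⟩

/-- The state of the learner is sound for the target `f` and the exploration probability `p`. -/
structure Sound (p : ℝ≥0∞) (f : X → Bool) (V : Version X) : Prop where
  mem : f ∈ V.hyps
  not_shatter : ¬ ALShatter V.hyps V.width V.depth
  prob : V.width = 1 ∨ p * p⁻¹ = 1

open Classical in
/-- A bound for the mistakes still to be made, apart from false alarms while exploring. -/
noncomputable def potential (p : ℝ≥0∞) (f : X → Bool) (V : Version X) : ℝ≥0∞ :=
  if V.Sound p f then V.depth + (V.width - 1 : ℕ) * p⁻¹ else ⊤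

variable {p : ℝ≥0∞} {f : X → Bool} {V : Version X} {x : X}

lemma Sound.depth_pos (h : V.Sound p f) : 0 < V.depth := by
  rcases Nat.eq_zero_or_pos V.depth with h0 | h0
  · refine absurd ?_ h.not_shatter
    rw [h0, ALShatter]
    exact ⟨f, h.mem⟩
  · exact h0

lemma Sound.width_pos (h : V.Sound p f) : 0 < V.width := by
  rcases Nat.eq_zero_or_pos V.width with h0 | h0
  · refine absurd ?_ h.not_shatter
    rw [h0, ALShatter_width_zero]
    exact ⟨f, h.mem⟩
  · exact h0

lemma Sound.next_of_not_explores (h : V.Sound p f) (hx : ¬ V.Explores x) (hf : f x = false) :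
    (V.next (x, some false)).Sound p f := by
  rw [next, if_neg hx]
  exact ⟨⟨h.mem, hf⟩, hx, h.prob⟩

lemma Sound.not_shatter_true (h : V.Sound p f) (hx : V.Explores x) :
    ¬ ALShatter {g | g ∈ V.hyps ∧ g x = true} (V.width - 1) (V.depth - 1) := by
  intro hs
  apply h.not_shatter
  obtain ⟨d, hd⟩ := Nat.exists_eq_add_one.2 h.depth_pos
  obtain ⟨w, hw⟩ := Nat.exists_eq_add_one.2 h.width_pos
  rw [Explores] at hx
  rw [hd, hw] at hs hx ⊢
  rw [ALShatter]
  exact ⟨x, hx, hs⟩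

lemma Sound.two_le_width (h : V.Sound p f) (hx : V.Explores x) (hf : f x = true) :
    2 ≤ V.width := by
  by_contra! hw
  have := h.width_pos
  refine h.not_shatter_true hx ?_
  rw [show V.width - 1 = 0 by omega, ALShatter_width_zero]
  exact ⟨f, h.mem, hf⟩

lemma Sound.next_of_explores (h : V.Sound p f) (hx : V.Explores x) (hf : f x = true) :
    (V.next (x, some true)).Sound p f := by
  rw [next, if_pos hx]
  refine ⟨⟨h.mem, hf⟩, h.not_shatter_true hx, Or.inr (h.prob.resolve_left ?_)⟩
  have := h.two_le_width hx hf
  omega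

end Version

/-- The Bernoulli distribution with parameter `p`. -/
noncomputable def coin (p : ℝ≥0∞) (hp : p ≤ 1) : PMF Bool :=
  PMF.ofFintype (fun b => cond b p (1 - p)) (by simp [add_tsub_cancel_of_le hp])

open Classical in
/-- The learner which predicts `1` with probability `p` when exploring, and surely otherwise. -/
noncomputable def learner (V : Version X) (p : ℝ≥0∞) (hp : p ≤ 1)
    (l : List (X × Option Bool)) (x : X) : PMF Bool :=
  if (l.foldl Version.next V).Explores x then coin p hp else PMF.pure true

lemma stepMean_learner_le {V : Version X} {p : ℝ≥0∞} {hp : p ≤ 1} (f : X → Bool) (x : X)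
    (s : List (X × Option Bool) × ℕ) :
    stepMean (learner V p hp) x (f x)
        (fun s => s.2 + (s.1.foldl Version.next V).potential p f) s ≤
      s.2 + (s.1.foldl Version.next V).potential p f + p := by
  obtain ⟨l, m⟩ := s
  simp only [stepMean, learner, List.foldl_append, List.foldl_cons, List.foldl_nil]
  generalize l.foldl Version.next V = U
  by_cases hU : U.Sound p f
  swap
  · simp [Version.potential, hU]
  obtain ⟨d, hd⟩ := Nat.exists_eq_add_one.2 hU.depth_pos
  have hnone : U.next (x, none) = U := rfl
  by_cases hx : U.Explores x
  · rw [if_pos hx]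
    have h1 : coin p hp true = p := by simp [coin]
    have h0 : coin p hp false = 1 - p := by simp [coin]
    rw [h1, h0, hnone]
    cases hf : f x with
    | false =>
      have hn : U.next (x, some false) = U := by rw [Version.next, if_pos hx]
      rw [hn]
      simp only [ne_eq, Bool.true_eq_false, not_false_eq_true, if_true, not_true_eq_false,
        if_false, add_zero]
      generalize U.potential p f = a
      push_cast
      calc p * (m + 1 + a) + (1 - p) * (m + a) = (p + (1 - p)) * (m + a) + p := by ring
        _ = m + a + p := by rw [add_tsub_cancel_of_le hp, one_mul]
        _ ≤ _ := le_rfl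
    | true =>
      have hS := hU.next_of_explores hx hf
      have hw := hU.two_le_width hx hf
      obtain ⟨w, hw⟩ : ∃ w, U.width = w + 2 := ⟨U.width - 2, by omega⟩
      have hpq : p * p⁻¹ = 1 := hU.prob.resolve_left (by omega)
      rw [Version.potential, Version.potential, if_pos hS, if_pos hU]
      have hn : U.next (x, some true) =
        ⟨{h | h ∈ U.hyps ∧ h x = true}, U.width - 1, U.depth - 1⟩ := by
        rw [Version.next, if_pos hx]
      rw [hn]
      simp only [hd, hw, ne_eq, not_true_eq_false, if_false, add_zero, Bool.false_eq_true,
        not_false_eq_true, if_true, Nat.add_sub_cancel, show w + 2 - 1 = w + 1 by omega]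
      push_cast
      generalize p⁻¹ = q at *
      have hc := add_tsub_cancel_of_le hp
      generalize 1 - p = r at *
      have key : r * (1 + q) ≤ q := by
        calc r * (1 + q) = r + r * q := by ring
          _ ≤ (p + r) + r * q := by gcongr; exact le_add_self
          _ = p * q + r * q := by rw [hc, hpq]
          _ = (p + r) * q := by ring
          _ = q := by rw [hc, one_mul]
      calc p * (m + (d + w * q)) + r * (m + 1 + (d + 1 + (w + 1) * q))
          ≤ p * (m + (d + 1 + w * q)) + r * (m + 1 + (d + 1 + (w + 1) * q)) := by
            gcongr; exact le_self_add
        _ = (p + r) * (m + (d + 1 + w * q)) + r * (1 + q) := by ring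
        _ ≤ 1 * (m + (d + 1 + w * q)) + q := by rw [hc]; gcongr
        _ = m + (d + 1 + (w + 1) * q) := by ring
        _ ≤ _ := le_self_add
  · rw [if_neg hx]
    simp only [PMF.pure_apply_self, one_mul, ne_eq, reduceCtorEq, not_false_eq_true,
      PMF.pure_apply_of_ne, zero_mul, add_zero]
    cases hf : f x with
    | false =>
      have hS := hU.next_of_not_explores hx hf
      rw [Version.potential, Version.potential, if_pos hS, if_pos hU]
      have hn : U.next (x, some false) =
        ⟨{h | h ∈ U.hyps ∧ h x = false}, U.width, U.depth - 1⟩ := by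
        rw [Version.next, if_neg hx]
      rw [hn]
      simp only [hd, Nat.add_sub_cancel, Bool.true_eq_false, not_false_eq_true, if_true]
      push_cast
      refine le_trans (le_of_eq ?_) le_self_add
      ring
    | true =>
      have hn : U.next (x, some true) = U := by rw [Version.next, if_neg hx]
      rw [hn]
      simp

lemma minimaxMistakes_le {H : Set (X → Bool)} {w n : ℕ} (h : ¬ ALShatter H w n) {p : ℝ≥0∞}
    (hp : p ≤ 1) (hwp : w = 1 ∨ p * p⁻¹ = 1) (T : ℕ) :
    minimaxMistakes H T ≤ n + (w - 1 : ℕ) * p⁻¹ + T * p := by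
  refine minimaxMistakes_le_of_learner (learner ⟨H, w, n⟩ p hp) fun f hf x => ?_
  have hS : Version.Sound p f ⟨H, w, n⟩ := ⟨hf, h, hwp⟩
  calc _ ≤ runMean (learner ⟨H, w, n⟩ p hp) x (fun t => f (x t)) T
          (fun s => s.2 + (s.1.foldl Version.next ⟨H, w, n⟩).potential p f) :=
        runMean_mono _ T fun s => le_self_add
    _ ≤ _ := runMean_le_of_stepMean_le _ (fun t s => stepMean_learner_le f (x t) s) T
    _ = _ := by simp [Version.potential, hS]

/-! ### Adversaries -/

lemma half_le_or_half_le_of_one_le_add {a b : ℝ≥0∞} (h : 1 ≤ a + b) : 1 / 2 ≤ a ∨ 1 / 2 ≤ b := by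
  by_contra! hab
  have := ENNReal.add_lt_add hab.1 hab.2
  rw [ENNReal.add_halves] at this
  exact absurd h (not_le.2 this)

lemma exists_stream_of_LShatter (A : List (X × Option Bool) → X → PMF Bool) {H : Set (X → Bool)}
    {d : ℕ} (hH : LShatter H d) (t : ℕ) (x : ℕ → X) (y : ℕ → Bool) :
    ∃ x' y', (∀ s < t, x s = x' s ∧ y s = y' s) ∧
      (∃ f ∈ H, ∀ s, t ≤ s → s < t + d → y' s = f (x' s)) ∧
      expMistakes A x y t + d * (1 / 2) ≤ expMistakes A x' y' (t + d) := by
  induction d generalizing H t x y with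
  | zero =>
    obtain ⟨f, hf⟩ : H.Nonempty := by simpa [LShatter] using hH
    exact ⟨x, y, by simp, ⟨f, hf, fun s _ _ => by omega⟩, by simp⟩
  | succ d ih =>
    rw [LShatter] at hH
    obtain ⟨x₀, h₀, h₁⟩ := hH
    obtain ⟨b, hb, hsh⟩ : ∃ b, 1 / 2 ≤ runMean A x y t (fun s => A s.1 x₀ (!b)) ∧
        LShatter {h | h ∈ H ∧ h x₀ = b} d := by
      have : 1 ≤ runMean A x y t (fun s => A s.1 x₀ true) +
          runMean A x y t (fun s => A s.1 x₀ false) := by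
        rw [← runMean_add]
        simp only [apply_true_add_apply_false, runMean_const, le_refl]
      rcases half_le_or_half_le_of_one_le_add this with h | h
      · exact ⟨false, h, h₀⟩
      · exact ⟨true, h, h₁⟩
    let x₁ := Function.update x t x₀
    let y₁ := Function.update y t b
    have hag : ∀ s < t, x s = x₁ s ∧ y s = y₁ s := fun s hs => by
      simp [x₁, y₁, Function.update_of_ne hs.ne]
    obtain ⟨x', y', hxy, ⟨f, hf, hfy⟩, hM⟩ := ih hsh (t + 1) x₁ y₁
    refine ⟨x', y', fun s hs => ?_, ⟨f, hf.1, fun s hs hs' => ?_⟩, ?_⟩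
    · rw [(hag s hs).1, (hag s hs).2]
      exact hxy s (by omega)
    · rcases hs.eq_or_lt with rfl | hlt
      · have := hxy t (by omega)
        rw [← this.1, ← this.2]
        simp [x₁, y₁, hf.2]
      · exact hfy s hlt (by omega)
    · rw [expMistakes_succ] at hM
      have hx₁ : x₁ t = x₀ := by simp [x₁]
      have hy₁ : y₁ t = b := by simp [y₁]
      rw [hx₁, hy₁, ← expMistakes_congr A hag] at hM
      rw [runMean, ← runAT_congr A hag, ← runMean] at hM
      rw [show t + (d + 1) = t + 1 + d by omega]
      refine le_trans ?_ hM
      calc _ = expMistakes A x y t + 1 / 2 + d * (1 / 2) := by push_cast; ring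
        _ ≤ _ := by gcongr

/-- The probability that the learner predicts `0` in each of `k` rounds with instance `x₀`. -/
noncomputable def silence (A : List (X × Option Bool) → X → PMF Bool) (x₀ : X) :
    ℕ → List (X × Option Bool) → ℝ≥0∞
  | 0, _ => 1
  | k + 1, l => A l x₀ false * silence A x₀ k (l ++ [(x₀, none)])

/-- The probability that the learner predicts `1` in some of `k` rounds with instance `x₀`. -/
noncomputable def detection (A : List (X × Option Bool) → X → PMF Bool) (x₀ : X) :
    ℕ → List (X × Option Bool) → ℝ≥0∞
  | 0, _ => 0
  | k + 1, l => A l x₀ true + A l x₀ false * detection A x₀ k (l ++ [(x₀, none)])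

section

variable (A : List (X × Option Bool) → X → PMF Bool) (x₀ : X)

lemma detection_add_silence (k : ℕ) (l : List (X × Option Bool)) :
    detection A x₀ k l + silence A x₀ k l = 1 := by
  induction k generalizing l with
  | zero => simp [detection, silence]
  | succ k ih => rw [detection, silence, add_assoc, ← mul_add, ih, mul_one,
      apply_true_add_apply_false]

lemma silence_le_one (k : ℕ) (l : List (X × Option Bool)) : silence A x₀ k l ≤ 1 :=
  detection_add_silence A x₀ k l ▸ le_add_self

lemma le_stepMean_detection (r : ℕ) (s : List (X × Option Bool) × ℕ) :
    s.2 + detection A x₀ (r + 1) s.1 ≤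
      stepMean A x₀ false (fun s => s.2 + detection A x₀ r s.1) s := by
  have h := apply_true_add_apply_false (A s.1 x₀)
  simp only [stepMean, detection, ne_eq, Bool.true_eq_false, not_false_eq_true, if_true,
    not_true_eq_false, if_false, add_zero]
  push_cast
  generalize A s.1 x₀ true = a at *
  generalize A s.1 x₀ false = b at *
  generalize detection A x₀ r (s.1 ++ [(x₀, none)]) = u
  calc (s.2 : ℝ≥0∞) + (a + b * u) = (a + b) * s.2 + (a + b * u) := by rw [h, one_mul]
    _ = a * (s.2 + 1) + b * (s.2 + u) := by ring
    _ ≤ _ := add_le_add (mul_le_mul' le_rfl le_self_add) le_rfl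

lemma le_stepMean_silence (r : ℕ) (s : List (X × Option Bool) × ℕ) :
    s.2 + (r + 1 : ℕ) * silence A x₀ (r + 1) s.1 ≤
      stepMean A x₀ true (fun s => s.2 + r * silence A x₀ r s.1) s := by
  have h := apply_true_add_apply_false (A s.1 x₀)
  simp only [stepMean, silence, ne_eq, Bool.false_eq_true, not_false_eq_true, if_true,
    not_true_eq_false, if_false, add_zero]
  push_cast
  have hu := silence_le_one A x₀ r (s.1 ++ [(x₀, none)])
  generalize A s.1 x₀ true = a at *
  generalize A s.1 x₀ false = b at *
  generalize silence A x₀ r (s.1 ++ [(x₀, none)]) = u at *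
  calc (s.2 : ℝ≥0∞) + (r + 1) * (b * u) = (a + b) * s.2 + b * (r * u + u) := by
        rw [h, one_mul]; ring
    _ ≤ (a + b) * s.2 + b * (r * u + 1) := by gcongr
    _ = a * s.2 + b * (s.2 + 1 + r * u) := by ring
    _ ≤ _ := by gcongr; exact le_self_add

/-- The stream `x` up to time `t`, constantly `a` from then on. -/
def constFrom {α : Type*} (x : ℕ → α) (t : ℕ) (a : α) (s : ℕ) : α := if s < t then x s else a

lemma constFrom_of_lt {α : Type*} (x : ℕ → α) {t s : ℕ} (a : α) (h : s < t) :
    constFrom x t a s = x s := if_pos h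

lemma constFrom_of_le {α : Type*} (x : ℕ → α) {t s : ℕ} (a : α) (h : t ≤ s) :
    constFrom x t a s = a := if_neg (not_lt.2 h)

lemma expMistakes_block (t m : ℕ) (x : ℕ → X) (y : ℕ → Bool) :
    expMistakes A x y t + 1 / 2 ≤
        expMistakes A (constFrom x t x₀) (constFrom y t false) (t + m) ∨
      m * (1 / 2) ≤ expMistakes A (constFrom x t x₀) (constFrom y t true) (t + m) := by
  have hrun (b : Bool) : runAT A (constFrom x t x₀) (constFrom y t b) t = runAT A x y t :=
    runAT_congr A fun s hs => ⟨constFrom_of_lt _ _ hs, constFrom_of_lt _ _ hs⟩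
  have hone : 1 ≤ runMean A x y t (fun s => detection A x₀ m s.1) +
      runMean A x y t (fun s => silence A x₀ m s.1) := by
    rw [← runMean_add]
    simp only [detection_add_silence, runMean_const, le_refl]
  refine (half_le_or_half_le_of_one_le_add hone).imp (fun h => ?_) fun h => ?_
  · have := runMean_le_of_le_stepMean A (x := constFrom x t x₀) (y := constFrom y t false) (t := t)
      (F := fun r s => s.2 + detection A x₀ r s.1) (fun j hj r s => by
        rw [constFrom_of_le _ _ hj, constFrom_of_le _ _ hj]
        exact le_stepMean_detection A x₀ r s) m
    rw [runMean_add, runMean, runMean, hrun] at this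
    simp only [detection, add_zero] at this
    exact le_trans (add_le_add le_rfl h) this
  · have := runMean_le_of_le_stepMean A (x := constFrom x t x₀) (y := constFrom y t true) (t := t)
      (F := fun r s => s.2 + r * silence A x₀ r s.1) (fun j hj r s => by
        rw [constFrom_of_le _ _ hj, constFrom_of_le _ _ hj]
        exact le_stepMean_silence A x₀ r s) m
    rw [runMean_add, runMean_const_mul, runMean, runMean, hrun] at this
    simp only [Nat.cast_zero, zero_mul, add_zero] at this
    exact le_trans (le_trans (by gcongr; exact h) le_add_self) this

end

lemma exists_stream_of_ALShatter_one (A : List (X × Option Bool) → X → PMF Bool) (m : ℕ)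
    {H : Set (X → Bool)} {d : ℕ} (hH : ALShatter H 1 d) (t : ℕ) (x : ℕ → X) (y : ℕ → Bool) :
    ∃ x' y', (∀ s < t, x s = x' s ∧ y s = y' s) ∧
      (∃ f ∈ H, ∀ s, t ≤ s → s < t + d * m → y' s = f (x' s)) ∧
      (expMistakes A x y t + d * (1 / 2) ≤ expMistakes A x' y' (t + d * m) ∨
        m * (1 / 2) ≤ expMistakes A x' y' (t + d * m)) := by
  induction d generalizing H t x y with
  | zero =>
    obtain ⟨f, hf⟩ := hH.nonempty
    exact ⟨x, y, by simp, ⟨f, hf, fun s _ _ => by omega⟩, by simp⟩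
  | succ d ih =>
    rw [ALShatter] at hH
    obtain ⟨x₀, h₀, h₁⟩ := hH
    have hag (b : Bool) : ∀ s < t, x s = constFrom x t x₀ s ∧ y s = constFrom y t b s :=
      fun s hs => ⟨(constFrom_of_lt _ _ hs).symm, (constFrom_of_lt _ _ hs).symm⟩
    have hlen : t + (d + 1) * m = t + m + d * m := by ring
    rw [hlen]
    rcases expMistakes_block A x₀ t m x y with h | h
    · obtain ⟨x', y', hxy, ⟨f, hf, hfy⟩, hM⟩ :=
        ih h₀ (t + m) (constFrom x t x₀) (constFrom y t false)
      refine ⟨x', y', fun s hs => ?_, ⟨f, hf.1, fun s hs hs' => ?_⟩, hM.imp_left fun hM => ?_⟩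
      · rw [(hag false s hs).1, (hag false s hs).2]
        exact hxy s (by omega)
      · rcases lt_or_ge s (t + m) with hlt | hge
        · rw [← (hxy s hlt).1, ← (hxy s hlt).2, constFrom_of_le _ _ hs, constFrom_of_le _ _ hs,
            hf.2]
        · exact hfy s hge hs'
      · calc _ = expMistakes A x y t + 1 / 2 + d * (1 / 2) := by push_cast; ring
          _ ≤ _ := by gcongr
          _ ≤ _ := hM
    · obtain ⟨f, hf⟩ := h₁.nonempty
      refine ⟨_, _, hag true, ⟨f, hf.1, fun s hs _ => ?_⟩,
        Or.inr (h.trans (expMistakes_mono A (by omega)))⟩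
      rw [constFrom_of_le _ _ hs, constFrom_of_le _ _ hs, hf.2]

lemma half_le_minimaxMistakes {H : Set (X → Bool)} {T : ℕ} (hT : 1 ≤ T) (h : LShatter H T) :
    (T : ℝ≥0∞) * (1 / 2) ≤ minimaxMistakes H T := by
  obtain ⟨x₀⟩ : Nonempty X := by
    obtain ⟨d, rfl⟩ : ∃ d, T = d + 1 := ⟨T - 1, by omega⟩
    rw [LShatter] at h
    exact h.nonempty
  refine le_minimaxMistakes fun A => ?_
  obtain ⟨x, y, -, ⟨f, hf, hfy⟩, hM⟩ :=
    exists_stream_of_LShatter A h 0 (fun _ => x₀) (fun _ => false)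
  refine ⟨f, hf, x, (le_add_self.trans hM).trans (le_of_eq ?_)⟩
  rw [zero_add] at *
  exact expMistakes_congr A fun s hs => ⟨rfl, hfy s (by omega) hs⟩

lemma sqrt_le_minimaxMistakes {H : Set (X → Bool)} (h : ∀ d, ALShatter H 1 d) (T : ℕ) :
    (Nat.sqrt T : ℝ≥0∞) * (1 / 2) ≤ minimaxMistakes H T := by
  obtain ⟨x₀⟩ : Nonempty X := by
    have := h 1
    rw [ALShatter] at this
    exact this.nonempty
  refine le_minimaxMistakes fun A => ?_
  obtain ⟨x, y, -, ⟨f, hf, hfy⟩, hM⟩ :=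
    exists_stream_of_ALShatter_one A (Nat.sqrt T) (h (Nat.sqrt T)) 0 (fun _ => x₀) (fun _ => false)
  have hM' : (Nat.sqrt T : ℝ≥0∞) * (1 / 2) ≤ expMistakes A x y (0 + Nat.sqrt T * Nat.sqrt T) :=
    hM.elim le_add_self.trans id
  refine ⟨f, hf, x, (hM'.trans (le_of_eq ?_)).trans (expMistakes_mono A (Nat.sqrt_le T))⟩
  rw [zero_add] at *
  exact expMistakes_congr A fun s hs => ⟨rfl, hfy s (by omega) hs⟩

end AppleTasting

/-- trichotomy for realizable apple tasting. The minimax expected number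
of mistakes is Θ(1) if W(H) = 1, Θ(√T) if 2 ≤ W(H) < ∞, and Θ(T) if W(H) = ∞. -/
theorem apple_tasting_trichotomy {X : Type*} (H : Set (X → Bool)) :
    (EffW H = 1 → ∃ C : ℝ≥0∞, C ≠ ⊤ ∧ ∀ T : ℕ, minimaxMistakes H T ≤ C) ∧
    (2 ≤ EffW H → EffW H ≠ ⊤ →
      ∃ c C : ℝ, 0 < c ∧ ∀ T : ℕ, 1 ≤ T →
        ENNReal.ofReal (c * Real.sqrt T) ≤ minimaxMistakes H T ∧
          minimaxMistakes H T ≤ ENNReal.ofReal (C * Real.sqrt T)) ∧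
    (EffW H = ⊤ → ∃ c : ℝ, 0 < c ∧ ∀ T : ℕ, 1 ≤ T →
        ENNReal.ofReal (c * T) ≤ minimaxMistakes H T ∧
          minimaxMistakes H T ≤ (T : ℝ≥0∞)) := by
  open AppleTasting in
  refine ⟨fun hW => ?_, fun hW hW' => ?_, fun hW => ?_⟩
  · obtain ⟨w, -, hw, hEq⟩ := exists_EffW_eq (H := H) (by simp [hW])
    obtain rfl : w = 1 := by rw [hW] at hEq; exact_mod_cast hEq.symm
    obtain ⟨n, hn⟩ := exists_not_ALShatter hw
    refine ⟨n, ENNReal.natCast_ne_top n, fun T => ?_⟩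
    simpa using minimaxMistakes_le hn (p := 0) zero_le_one (Or.inl rfl) T
  · obtain ⟨w, hw1, hw, -⟩ := exists_EffW_eq hW'
    obtain ⟨n, hn⟩ := exists_not_ALShatter hw
    refine ⟨1 / 4, n + w, by norm_num, fun T hT => ⟨?_, ?_⟩⟩
    · have hsh := ALShatter_of_ALdim_eq_top (H := H) (w := 1)
        (ALdim_eq_top_of_lt_EffW le_rfl (lt_of_lt_of_le (by norm_num) hW))
      refine le_trans ?_ (sqrt_le_minimaxMistakes hsh T)
      have h1 : (1 : ℝ) ≤ Nat.sqrt T := by exact_mod_cast Nat.sqrt_pos.2 hT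
      have h2 : Real.sqrt T ≤ Nat.sqrt T + 1 := Real.real_sqrt_le_nat_sqrt_succ
      calc _ ≤ ENNReal.ofReal (Nat.sqrt T * (1 / 2)) :=
            ENNReal.ofReal_le_ofReal (by linarith)
        _ = _ := by
          rw [ENNReal.ofReal_mul (by positivity), ENNReal.ofReal_natCast,
            ENNReal.ofReal_div_of_pos (by norm_num)]
          simp
    · have hs : (1 : ℝ) ≤ Real.sqrt T := Real.one_le_sqrt.2 (by exact_mod_cast hT)
      have hs0 : (0 : ℝ) < Real.sqrt T := by linarith
      have hq : (ENNReal.ofReal (Real.sqrt T)⁻¹)⁻¹ = ENNReal.ofReal (Real.sqrt T) := by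
        rw [ENNReal.ofReal_inv_of_pos hs0, inv_inv]
      refine (minimaxMistakes_le hn (p := ENNReal.ofReal (Real.sqrt T)⁻¹) ?_ (Or.inr ?_) T).trans ?_
      · exact ENNReal.ofReal_le_one.2 (inv_le_one_of_one_le₀ hs)
      · rw [hq, ← ENNReal.ofReal_mul (by positivity), inv_mul_cancel₀ hs0.ne', ENNReal.ofReal_one]
      · rw [hq, ← ENNReal.ofReal_natCast n, ← ENNReal.ofReal_natCast (w - 1),
          ← ENNReal.ofReal_natCast T, ← ENNReal.ofReal_mul (by positivity),
          ← ENNReal.ofReal_mul (by positivity), ← ENNReal.ofReal_add (by positivity) (by positivity),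
          ← ENNReal.ofReal_add (by positivity) (by positivity)]
        refine ENNReal.ofReal_le_ofReal ?_
        have hTs : (T : ℝ) * (Real.sqrt T)⁻¹ = Real.sqrt T := by
          rw [← div_eq_mul_inv, Real.div_sqrt]
        rw [hTs, Nat.cast_sub hw1]
        have : (n : ℝ) ≤ n * Real.sqrt T := le_mul_of_one_le_right (by positivity) hs
        push_cast
        linarith
  · refine ⟨1 / 2, by norm_num, fun T hT => ⟨?_, minimaxMistakes_le_rounds H T⟩⟩
    have hsh := ALShatter_of_ALdim_eq_top (H := H) (w := T)
      (ALdim_eq_top_of_lt_EffW hT (hW ▸ ENat.natCast_lt_top T)) T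
    refine le_trans (le_of_eq ?_) (half_le_minimaxMistakes hT (hsh.toLShatter le_rfl))
    rw [mul_comm, ENNReal.ofReal_mul (by positivity), ENNReal.ofReal_natCast,
      ENNReal.ofReal_div_of_pos (by norm_num)]
    simp
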